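/- arXiv:1405.4270 — 2 statements merged into one kernel-verified Lean document; each statement's English description precedes it below -/
import Mathlib

section
/- Fix a real α with 0 < α ≤ 1, and let λ₁, λ₂ > 0 and θ₁, θ₂ > 0 be positive reals such that (λ₁, λ₂) is majorized by (θ₁, θ₂), i.e., λ₁ + λ₂ = θ₁ + θ₂ and max(λ₁, λ₂) ≤ max(θ₁, θ₂). Then the lifetime of the parallel system of two independent Weibull components with scale parameters (λ₁, λ₂) is smaller in the likelihood ratio order than the one with scale parameters (θ₁, θ₂); that is, the ratio of densities f_{2:2}^θ(t) / f_{2:2}^λ(t) is increasing in t on (0, ∞). -/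
open Real Set

/-- The slope of `exp` between `0` and `x`. -/
noncomputable def expSlope (x : ℝ) : ℝ := (exp x - 1) / x

/-- The derivative of `expSlope` away from `0`. -/
noncomputable def expSlopeDeriv (x : ℝ) : ℝ := (exp x - expSlope x) / x

lemma expSlope_mul_self {x : ℝ} (hx : 0 < x) : expSlope x * x = exp x - 1 := by
  unfold expSlope; field_simp

lemma expSlopeDeriv_mul_self {x : ℝ} (hx : 0 < x) :
    expSlopeDeriv x * x = exp x - expSlope x := by
  unfold expSlopeDeriv; field_simp

lemma expSlope_pos {x : ℝ} (hx : 0 < x) : 0 < expSlope x :=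
  div_pos (by linarith [one_lt_exp_iff.2 hx]) hx

lemma hasDerivAt_expSlope {x : ℝ} (hx : 0 < x) :
    HasDerivAt expSlope (expSlopeDeriv x) x := by
  have h := ((Real.hasDerivAt_exp x).sub_const 1).div (hasDerivAt_id x) hx.ne'
  refine h.congr_deriv ?_
  simp only [expSlopeDeriv, expSlope, id]
  field_simp

lemma expSlopeDeriv_nonneg {x : ℝ} (hx : 0 < x) : 0 ≤ expSlopeDeriv x := by
  refine div_nonneg ?_ hx.le
  rw [expSlope, sub_nonneg, div_le_iff₀ hx]
  have h := add_one_le_exp (-x)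
  have h2 : exp x * exp (-x) = 1 := by rw [← exp_add]; simp
  nlinarith [exp_pos x]

lemma expSlopeDeriv_sub_mul_le {x y : ℝ} (hy : 0 < y) (hyx : y ≤ x) :
    (exp x + exp y) * (expSlopeDeriv x - expSlopeDeriv y) ≤
      (exp x - exp y) * (expSlope x + expSlope y) := by
  have hx : 0 < x := hy.trans_le hyx
  let J : ℝ → ℝ := fun a =>
    (exp x - exp y) * (exp (a * x) / x + exp (a * y) / y) -
      (exp x + exp y) * ((a * exp (a * x) / x - exp (a * x) / x ^ 2) -
        (a * exp (a * y) / y - exp (a * y) / y ^ 2))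
  have hJ : ∀ a : ℝ, HasDerivAt J ((exp x - exp y) * (exp (a * x) + exp (a * y)) -
      (exp x + exp y) * (a * (exp (a * x) - exp (a * y)))) a := by
    intro a
    have e (c : ℝ) : HasDerivAt (fun a : ℝ => exp (a * c)) (exp (a * c) * c) a := by
      simpa using ((hasDerivAt_id a).mul_const c).exp
    have k (c : ℝ) := (((hasDerivAt_id a).mul (e c)).div_const c).sub ((e c).div_const (c ^ 2))
    have h := ((((e x).div_const x).add ((e y).div_const y)).const_mul (exp x - exp y)).sub
      (((k x).sub (k y)).const_mul (exp x + exp y))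
    refine h.congr_deriv ?_
    simp only [id]
    field_simp
    ring
  have hmono : MonotoneOn J (Icc 0 1) := by
    refine monotoneOn_of_hasDerivWithinAt_nonneg (convex_Icc 0 1)
      (fun a _ => (hJ a).continuousAt.continuousWithinAt)
      (fun a _ => (hJ a).hasDerivWithinAt) ?_
    intro a ha
    rw [interior_Icc] at ha
    obtain ⟨ha0, ha1⟩ := ha
    have h1 : exp (a * y) ≤ exp (a * x) := exp_le_exp.2 (by nlinarith)
    have h2 : exp y * exp (a * x) ≤ exp x * exp (a * y) := by
      rw [← exp_add, ← exp_add]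
      exact exp_le_exp.2 (by nlinarith)
    have h3 : a * (exp (a * x) - exp (a * y)) ≤ exp (a * x) - exp (a * y) := by nlinarith
    have h4 := mul_le_mul_of_nonneg_left h3 (add_pos (exp_pos x) (exp_pos y)).le
    linarith
  have h := hmono (left_mem_Icc.2 zero_le_one) (right_mem_Icc.2 zero_le_one) zero_le_one
  have hJ0 : J 1 - J 0 = (exp x - exp y) * (expSlope x + expSlope y) -
      (exp x + exp y) * (expSlopeDeriv x - expSlopeDeriv y) := by
    simp only [J, expSlope, expSlopeDeriv, one_mul, zero_mul, exp_zero]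
    field_simp
    ring
  linarith

lemma exp_mul_expSlope_add_sub_le {x y : ℝ} (hy : 0 < y) (hyx : y ≤ x) :
    exp y * (expSlope x + expSlope y) - (exp x + exp y) * expSlopeDeriv y ≤
      (expSlope x + expSlope y) ^ 2 := by
  have hx : 0 < x := hy.trans_le hyx
  have h1 := expSlope_mul_self hx
  have h2 := expSlope_mul_self hy
  have h3 := expSlopeDeriv_mul_self hy
  have hz := expSlope_pos hx
  have hw := expSlope_pos hy
  have hp := expSlopeDeriv_nonneg hy
  have key : (expSlope x + expSlope y) ^ 2 -
      (exp y * (expSlope x + expSlope y) - (exp x + exp y) * expSlopeDeriv y) =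
      expSlope x ^ 2 + expSlope x * expSlope y + 2 * expSlopeDeriv y +
        (x - y) * (expSlope x * expSlopeDeriv y) := by
    linear_combination (-expSlopeDeriv y) * h1 + (-expSlopeDeriv y) * h2 +
      (expSlope x + expSlope y) * h3
  have := mul_nonneg (sub_nonneg.2 hyx) (mul_nonneg hz.le hp)
  nlinarith [mul_pos hz hw, sq_nonneg (expSlope x)]

/-- The elasticity `r h'(r) / h(r)` of `h = parallelExpDensity A B`, where `x = A r`, `y = B r`. -/
noncomputable def parallelElasticity (x y : ℝ) : ℝ :=
  -(x + y) + (exp x + exp y) / (expSlope x + expSlope y)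

/-- The density of the maximum of two independent exponential variables of rates `A` and `B`. -/
noncomputable def parallelExpDensity (A B r : ℝ) : ℝ :=
  A * exp (-(A * r)) * (1 - exp (-(B * r))) + B * exp (-(B * r)) * (1 - exp (-(A * r)))

lemma parallelExpDensity_comm (A B r : ℝ) :
    parallelExpDensity A B r = parallelExpDensity B A r := by
  unfold parallelExpDensity; ring

lemma parallelExpDensity_pos {A B r : ℝ} (hA : 0 < A) (hB : 0 < B) (hr : 0 < r) :
    0 < parallelExpDensity A B r := by
  have h (C : ℝ) (hC : 0 < C) : 0 < 1 - exp (-(C * r)) :=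
    by simpa using mul_pos hC hr
  exact add_pos (mul_pos (mul_pos hA (exp_pos _)) (h B hB))
    (mul_pos (mul_pos hB (exp_pos _)) (h A hA))

lemma hasDerivAt_parallelExpDensity {A B r : ℝ} (hA : 0 < A) (hB : 0 < B) (hr : 0 < r) :
    HasDerivAt (parallelExpDensity A B)
      (parallelElasticity (A * r) (B * r) * parallelExpDensity A B r / r) r := by
  have e (C : ℝ) : HasDerivAt (fun r : ℝ => exp (-(C * r))) (exp (-(C * r)) * -C) r := by
    simpa using (((hasDerivAt_id r).const_mul C).neg).exp
  have h := (((e A).const_mul A).mul ((e B).const_sub 1)).add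
    (((e B).const_mul B).mul ((e A).const_sub 1))
  refine h.congr_deriv ?_
  have hx := mul_pos hA hr
  have hy := mul_pos hB hr
  have hg : expSlope (A * r) + expSlope (B * r) ≠ 0 :=
    (add_pos (expSlope_pos hx) (expSlope_pos hy)).ne'
  have hdens : parallelExpDensity A B r = A * B * r * exp (-(A * r)) * exp (-(B * r)) *
      (expSlope (A * r) + expSlope (B * r)) := by
    simp only [parallelExpDensity, expSlope, exp_neg]
    field_simp
    ring
  have hmul : (exp (A * r) + exp (B * r)) / (expSlope (A * r) + expSlope (B * r)) *
      parallelExpDensity A B r = A * B * r * (exp (-(A * r)) + exp (-(B * r))) := by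
    rw [hdens, div_mul_eq_mul_div, div_eq_iff hg, exp_neg, exp_neg]
    field_simp
    ring
  rw [parallelElasticity, add_mul, hmul, parallelExpDensity]
  field_simp
  ring

lemma monotoneOn_parallelElasticity_rpow {α r S : ℝ} (hα : 0 < α) (hα1 : α ≤ 1) (hr : 0 < r) :
    MonotoneOn (fun u : ℝ => parallelElasticity (u ^ α * r) ((S - u) ^ α * r))
      (Ico (S / 2) S ∩ Ioi 0) := by
  have hd : ∀ u : ℝ, 0 < u → u < S →
      HasDerivAt (fun u : ℝ => parallelElasticity (u ^ α * r) ((S - u) ^ α * r))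
        (α * r * ((u ^ (α - 1) *
            ((exp (u ^ α * r) * (expSlope (u ^ α * r) + expSlope ((S - u) ^ α * r)) -
              (exp (u ^ α * r) + exp ((S - u) ^ α * r)) * expSlopeDeriv (u ^ α * r)) -
              (expSlope (u ^ α * r) + expSlope ((S - u) ^ α * r)) ^ 2) -
          (S - u) ^ (α - 1) *
            ((exp ((S - u) ^ α * r) * (expSlope (u ^ α * r) + expSlope ((S - u) ^ α * r)) -
              (exp (u ^ α * r) + exp ((S - u) ^ α * r)) * expSlopeDeriv ((S - u) ^ α * r)) -
              (expSlope (u ^ α * r) + expSlope ((S - u) ^ α * r)) ^ 2)) /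
          (expSlope (u ^ α * r) + expSlope ((S - u) ^ α * r)) ^ 2)) u := by
    intro u hu huS
    have hv : 0 < S - u := sub_pos.2 huS
    have hx : 0 < u ^ α * r := mul_pos (rpow_pos_of_pos hu α) hr
    have hy : 0 < (S - u) ^ α * r := mul_pos (rpow_pos_of_pos hv α) hr
    have hX : HasDerivAt (fun u : ℝ => u ^ α * r) (α * u ^ (α - 1) * r) u :=
      (hasDerivAt_rpow_const (Or.inl hu.ne')).mul_const r
    have hY : HasDerivAt (fun u : ℝ => (S - u) ^ α * r) (-(α * (S - u) ^ (α - 1) * r)) u := by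
      have h := ((hasDerivAt_id u).const_sub S).rpow_const (p := α) (Or.inl hv.ne')
      refine (h.mul_const r).congr_deriv ?_
      simp only [id]
      ring
    have hG := add_pos (expSlope_pos hx) (expSlope_pos hy)
    have hgX : HasDerivAt (fun u : ℝ => expSlope (u ^ α * r))
        (expSlopeDeriv (u ^ α * r) * (α * u ^ (α - 1) * r)) u :=
      HasDerivAt.comp (h₂ := expSlope) u (hasDerivAt_expSlope hx) hX
    have hgY : HasDerivAt (fun u : ℝ => expSlope ((S - u) ^ α * r))
        (expSlopeDeriv ((S - u) ^ α * r) * -(α * (S - u) ^ (α - 1) * r)) u :=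
      HasDerivAt.comp (h₂ := expSlope) u (hasDerivAt_expSlope hy) hY
    have h := ((hX.add hY).neg).add ((hX.exp.add hY.exp).div (hgX.add hgY) hG.ne')
    refine h.congr_deriv ?_
    simp only [Pi.add_apply]
    have hG' := hG.ne'
    generalize (S - u) ^ α * r = y at hG' ⊢
    generalize u ^ α * r = x at hG' ⊢
    field_simp
    ring
  refine monotoneOn_of_hasDerivWithinAt_nonneg ((convex_Ico _ _).inter (convex_Ioi _))
    (fun u hu => (hd u hu.2 hu.1.2).continuousAt.continuousWithinAt)
    (fun u hu => (hd u (interior_subset hu).2 (interior_subset hu).1.2).hasDerivWithinAt) ?_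
  intro u hu
  obtain ⟨⟨hu2, huS⟩, hu0⟩ := interior_subset hu
  have hu0 : 0 < u := hu0
  have hv : 0 < S - u := sub_pos.2 huS
  have hvu : S - u ≤ u := by linarith
  have hy : 0 < (S - u) ^ α * r := mul_pos (rpow_pos_of_pos hv α) hr
  have hyx : (S - u) ^ α * r ≤ u ^ α * r :=
    mul_le_mul_of_nonneg_right (rpow_le_rpow hv.le hvu hα.le) hr.le
  have hpq : u ^ (α - 1) ≤ (S - u) ^ (α - 1) :=
    rpow_le_rpow_of_nonpos hv hvu (by linarith)
  have hp : 0 ≤ u ^ (α - 1) := rpow_nonneg hu0.le _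
  have h1 := expSlopeDeriv_sub_mul_le hy hyx
  have h2 := exp_mul_expSlope_add_sub_le hy hyx
  refine mul_nonneg (mul_pos hα hr).le (div_nonneg ?_ (sq_nonneg _))
  rw [sub_nonneg]
  refine (mul_le_mul_of_nonpos_right hpq (sub_nonpos.2 h2)).trans
    (mul_le_mul_of_nonneg_left ?_ hp)
  linarith

lemma parallelElasticity_rpow_le {α a b c d r : ℝ} (hα : 0 < α) (hα1 : α ≤ 1) (hr : 0 < r)
    (hb : 0 < b) (hd : 0 < d) (hba : b ≤ a) (hac : a ≤ c) (hsum : a + b = c + d) :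
    parallelElasticity (a ^ α * r) (b ^ α * r) ≤ parallelElasticity (c ^ α * r) (d ^ α * r) := by
  have h := monotoneOn_parallelElasticity_rpow (S := a + b) hα hα1 hr
    (a := a) ⟨⟨by linarith, by linarith⟩, mem_Ioi.2 (by linarith)⟩
    (b := c) ⟨⟨by linarith, by linarith⟩, mem_Ioi.2 (by linarith)⟩ hac
  have h1 : a + b - a = b := by ring
  have h2 : a + b - c = d := by linarith
  simpa only [h1, h2] using h

lemma monotoneOn_parallelExpDensity_div {α a b c d : ℝ} (hα : 0 < α) (hα1 : α ≤ 1)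
    (hb : 0 < b) (hd : 0 < d) (hba : b ≤ a) (hac : a ≤ c) (hsum : a + b = c + d) :
    MonotoneOn (fun r => parallelExpDensity (c ^ α) (d ^ α) r /
      parallelExpDensity (a ^ α) (b ^ α) r) (Ioi 0) := by
  have hA : 0 < a ^ α := rpow_pos_of_pos (hb.trans_le hba) α
  have hB : 0 < b ^ α := rpow_pos_of_pos hb α
  have hC : 0 < c ^ α := rpow_pos_of_pos (hb.trans_le (hba.trans hac)) α
  have hD : 0 < d ^ α := rpow_pos_of_pos hd α
  have hder (r : ℝ) (hr : 0 < r) := (hasDerivAt_parallelExpDensity hC hD hr).div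
    (hasDerivAt_parallelExpDensity hA hB hr) (parallelExpDensity_pos hA hB hr).ne'
  refine monotoneOn_of_hasDerivWithinAt_nonneg (convex_Ioi 0)
    (fun r hr => (hder r hr).continuousAt.continuousWithinAt)
    (fun r hr => (hder r (interior_subset hr)).hasDerivWithinAt) ?_
  intro r hr
  have hr : 0 < r := interior_subset hr
  have hle := parallelElasticity_rpow_le hα hα1 hr hb hd hba hac hsum
  refine div_nonneg ?_ (sq_nonneg _)
  have hpos := mul_pos (parallelExpDensity_pos hC hD hr) (parallelExpDensity_pos hA hB hr)
  have := div_nonneg (mul_nonneg (sub_nonneg.2 hle) hpos.le) hr.le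
  convert this using 1
  ring

lemma parallelWeibullDensity_eq {α a b t : ℝ} (hα : 0 < α) (ha : 0 < a) (hb : 0 < b)
    (ht : 0 < t) :
    (1 - exp (-((a * t) ^ α))) * (1 - exp (-((b * t) ^ α))) *
        (α * a ^ α * t ^ (α - 1) / (exp ((a * t) ^ α) - 1) +
          α * b ^ α * t ^ (α - 1) / (exp ((b * t) ^ α) - 1)) =
      α * t ^ (α - 1) * parallelExpDensity (a ^ α) (b ^ α) (t ^ α) := by
  have hne {c : ℝ} (hc : 0 < c) : exp (c ^ α * t ^ α) - 1 ≠ 0 :=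
    (sub_pos.2 (one_lt_exp_iff.2 (mul_pos (rpow_pos_of_pos hc α) (rpow_pos_of_pos ht α)))).ne'
  have h1 := hne ha
  have h2 := hne hb
  rw [mul_rpow ha.le ht.le, mul_rpow hb.le ht.le, parallelExpDensity, exp_neg, exp_neg]
  have h3 := exp_pos (a ^ α * t ^ α)
  have h4 := exp_pos (b ^ α * t ^ α)
  generalize exp (a ^ α * t ^ α) = E at h1 h3 ⊢
  generalize exp (b ^ α * t ^ α) = F at h2 h4 ⊢
  field_simp

lemma monotoneOn_parallelExpDensity_div_of_max_le {α a b c d : ℝ} (hα : 0 < α) (hα1 : α ≤ 1)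
    (ha : 0 < a) (hb : 0 < b) (hc : 0 < c) (hd : 0 < d) (hsum : a + b = c + d)
    (hmax : max a b ≤ max c d) :
    MonotoneOn (fun r => parallelExpDensity (c ^ α) (d ^ α) r /
      parallelExpDensity (a ^ α) (b ^ α) r) (Ioi 0) := by
  wlog hba : b ≤ a generalizing a b
  · simp only [parallelExpDensity_comm (a ^ α) (b ^ α)]
    exact this hb ha (by linarith) (by rwa [max_comm]) (not_le.1 hba).le
  wlog hdc : d ≤ c generalizing c d
  · simp only [parallelExpDensity_comm (c ^ α) (d ^ α)]
    exact this hd hc (by linarith) (by rwa [max_comm d c]) (not_le.1 hdc).le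
  rw [max_eq_left hba, max_eq_left hdc] at hmax
  exact monotoneOn_parallelExpDensity_div hα hα1 hb hd hba hmax hsum

/-- For `0 < α ≤ 1`, if `(λ₁, λ₂) ≼^m (θ₁, θ₂)` (i.e. `λ₁ + λ₂ = θ₁ + θ₂` and
`max(λ₁,λ₂) ≤ max(θ₁,θ₂)`), then `X_{2:2}^λ ≤_lr X_{2:2}^θ`: the ratio of densities
`f_{2:2}^θ(t) / f_{2:2}^λ(t)` of the parallel Weibull systems is increasing in `t`
on `(0, ∞)`, where
`f_{2:2}^λ(t) = (1 − e^{−(λ₁ t)^α})(1 − e^{−(λ₂ t)^α}) · Σᵢ α λᵢ^α t^{α−1} / (e^{(λᵢ t)^α} − 1)`. -/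
theorem parallel_weibull_lr_order_majorization
    (α lam₁ lam₂ θ₁ θ₂ : ℝ) (hα : 0 < α) (hα1 : α ≤ 1)
    (hlam₁ : 0 < lam₁) (hlam₂ : 0 < lam₂) (hθ₁ : 0 < θ₁) (hθ₂ : 0 < θ₂)
    (hsum : lam₁ + lam₂ = θ₁ + θ₂) (hmax : max lam₁ lam₂ ≤ max θ₁ θ₂) :
    MonotoneOn
      (fun t : ℝ =>
        ((1 - exp (-((θ₁ * t) ^ α))) * (1 - exp (-((θ₂ * t) ^ α))) *
            (α * θ₁ ^ α * t ^ (α - 1) / (exp ((θ₁ * t) ^ α) - 1) +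
              α * θ₂ ^ α * t ^ (α - 1) / (exp ((θ₂ * t) ^ α) - 1))) /
          ((1 - exp (-((lam₁ * t) ^ α))) * (1 - exp (-((lam₂ * t) ^ α))) *
            (α * lam₁ ^ α * t ^ (α - 1) / (exp ((lam₁ * t) ^ α) - 1) +
              α * lam₂ ^ α * t ^ (α - 1) / (exp ((lam₂ * t) ^ α) - 1))))
      (Ioi (0 : ℝ)) := by
  have hmono := monotoneOn_parallelExpDensity_div_of_max_le hα hα1 hlam₁ hlam₂ hθ₁ hθ₂ hsum hmax
  have hcomp : MonotoneOn (fun t : ℝ => parallelExpDensity (θ₁ ^ α) (θ₂ ^ α) (t ^ α) /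
      parallelExpDensity (lam₁ ^ α) (lam₂ ^ α) (t ^ α)) (Ioi 0) := fun s hs t ht hst =>
    hmono (rpow_pos_of_pos hs α) (rpow_pos_of_pos ht α)
      (rpow_le_rpow (le_of_lt hs) hst hα.le)
  refine hcomp.congr fun t ht => ?_
  have ht : 0 < t := ht
  have hne : α * t ^ (α - 1) ≠ 0 := (mul_pos hα (rpow_pos_of_pos ht _)).ne'
  simp only [parallelWeibullDensity_eq hα hθ₁ hθ₂ ht, parallelWeibullDensity_eq hα hlam₁ hlam₂ ht]
  exact (mul_div_mul_left _ _ hne).symm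
end

section
/- Fix a real α with 0 < α ≤ 1, positive integers p, q with p + q = n, and positive reals λ₁, λ₂, θ₁, θ₂ such that the vector consisting of p copies of λ₁ followed by q copies of λ₂ is majorized by the vector of p copies of θ₁ followed by q copies of θ₂. Then the ratio of reverse hazard rates of the two multiple-outlier parallel systems, r_{n:n}^θ(t) / r_{n:n}^λ(t) = [p·u(θ₁ t) + q·u(θ₂ t)] / [p·u(λ₁ t) + q·u(λ₂ t)], where u(s) = s^α / (e^{s^α} − 1), is increasing in t on (0, ∞). -/
open Real Set

/-- `x` is weakly majorized (from below) by `y`: for every `j`, the sum of the `j`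
smallest components of `x` is at least the sum of the `j` smallest components of `y`.
Equivalently: for every subset `s` of indices there is a subset `u` of the same
cardinality with `∑_{i ∈ u} y i ≤ ∑_{i ∈ s} x i`. -/
def WeaklyMajorizedBy {n : ℕ} (x y : Fin n → ℝ) : Prop :=
  ∀ s : Finset (Fin n), ∃ u : Finset (Fin n),
    u.card = s.card ∧ ∑ i ∈ u, y i ≤ ∑ i ∈ s, x i

/-- `x` is majorized by `y`: the partial sums of the `j` smallest components of `x`
dominate those of `y`, and the total sums agree. -/
def MajorizedBy {n : ℕ} (x y : Fin n → ℝ) : Prop :=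
  WeaklyMajorizedBy x y ∧ ∑ i, x i = ∑ i, y i

/-- A positive function `v` on `(0, ∞)` with elasticity `ρ = s v' / v`, such that `v` is
decreasing and convex, and `g = -v ρ'` is positive and decreasing. -/
structure ElasticityProfile (v ρ g : ℝ → ℝ) : Prop where
  pos : ∀ s, 0 < s → 0 < v s
  hasDerivAt : ∀ s, 0 < s → HasDerivAt v (v s * ρ s / s) s
  nonpos : ∀ s, 0 < s → ρ s ≤ 0
  hasDerivAt_elasticity : ∀ s, 0 < s → HasDerivAt ρ (-(g s / v s)) s
  g_pos : ∀ s, 0 < s → 0 < g s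
  g_anti : ∀ s t, 0 < s → s ≤ t → g t ≤ g s
  deriv_mono : ∀ s t, 0 < s → s ≤ t → v s * ρ s / s ≤ v t * ρ t / t

namespace ElasticityProfile

variable {v ρ g : ℝ → ℝ}

lemma elasticity_strictAntiOn (h : ElasticityProfile v ρ g) : StrictAntiOn ρ (Ioi 0) := by
  refine strictAntiOn_of_deriv_neg (convex_Ioi 0)
    (fun s hs => (h.hasDerivAt_elasticity s hs).continuousAt.continuousWithinAt) fun s hs => ?_
  rw [interior_Ioi] at hs
  rw [(h.hasDerivAt_elasticity s hs).deriv]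
  exact neg_neg_of_pos (div_pos (h.g_pos s hs) (h.pos s hs))

lemma elasticity_anti (h : ElasticityProfile v ρ g) {s t : ℝ} (hs : 0 < s) (hst : s ≤ t) :
    ρ t ≤ ρ s :=
  h.elasticity_strictAntiOn.antitoneOn hs (hs.trans_le hst) hst

lemma elasticity_lt (h : ElasticityProfile v ρ g) {s t : ℝ} (hs : 0 < s) (hst : s < t) :
    ρ t < ρ s :=
  h.elasticity_strictAntiOn hs (hs.trans hst) hst

lemma hasDerivAt_mul_sub (h : ElasticityProfile v ρ g) (c : ℝ) {s : ℝ} (hs : 0 < s) :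
    HasDerivAt (fun s => v s * (ρ s - c)) (v s * ρ s / s * (ρ s - c) - g s) s := by
  have hd := (h.hasDerivAt s hs).mul ((h.hasDerivAt_elasticity s hs).sub_const c)
  refine hd.congr_deriv ?_
  have := (h.pos s hs).ne'
  field_simp
  ring

lemma deriv_nonpos (h : ElasticityProfile v ρ g) {s : ℝ} (hs : 0 < s) : v s * ρ s / s ≤ 0 :=
  div_nonpos_of_nonpos_of_nonneg
    (mul_nonpos_of_nonneg_of_nonpos (h.pos s hs).le (h.nonpos s hs)) hs.le

/-- Mean value theorem for `v * (ρ - c)`. -/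
lemma exists_mul_sub_slope (h : ElasticityProfile v ρ g) (c : ℝ) {x y : ℝ} (hx : 0 < x)
    (hxy : x ≤ y) : ∃ z, x ≤ z ∧ z ≤ y ∧
      v y * (ρ y - c) - v x * (ρ x - c) = (v z * ρ z / z * (ρ z - c) - g z) * (y - x) := by
  rcases hxy.eq_or_lt with rfl | hlt
  · exact ⟨x, le_rfl, le_rfl, by ring⟩
  obtain ⟨z, hz, he⟩ := exists_hasDerivAt_eq_slope (fun s => v s * (ρ s - c))
    (fun z => v z * ρ z / z * (ρ z - c) - g z) hlt
    (fun s hs => (h.hasDerivAt_mul_sub c (hx.trans_le hs.1)).continuousAt.continuousWithinAt)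
    (fun s hs => h.hasDerivAt_mul_sub c (hx.trans hs.1))
  refine ⟨z, hz.1.le, hz.2.le, ?_⟩
  rw [he, div_mul_cancel₀ _ (sub_pos.2 hlt).ne']

lemma mul_sub_slope_le_left (h : ElasticityProfile v ρ g) {x y s : ℝ} (hx : 0 < x)
    (hxy : x ≤ y) (hys : y ≤ s) :
    v y * (ρ y - ρ s) - v x * (ρ x - ρ s) ≤ -g s * (y - x) := by
  obtain ⟨z, hxz, hzy, he⟩ := h.exists_mul_sub_slope (ρ s) hx hxy
  have hz := hx.trans_le hxz
  rw [he]
  refine mul_le_mul_of_nonneg_right ?_ (sub_nonneg.2 hxy)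
  have h1 := mul_nonpos_of_nonpos_of_nonneg (h.deriv_nonpos hz)
    (sub_nonneg.2 (h.elasticity_anti hz (hzy.trans hys)))
  linarith [h.g_anti z s hz (hzy.trans hys)]

lemma le_mul_sub_slope_right (h : ElasticityProfile v ρ g) {x y s : ℝ} (hs : 0 < s)
    (hsx : s ≤ x) (hxy : x ≤ y) :
    -g s * (y - x) ≤ v y * (ρ y - ρ s) - v x * (ρ x - ρ s) := by
  obtain ⟨z, hxz, hzy, he⟩ := h.exists_mul_sub_slope (ρ s) (hs.trans_le hsx) hxy
  have hsz := hsx.trans hxz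
  rw [he]
  refine mul_le_mul_of_nonneg_right ?_ (sub_nonneg.2 hxy)
  have h1 := mul_nonneg_of_nonpos_of_nonpos (h.deriv_nonpos (hs.trans_le hsz))
    (sub_nonpos.2 (h.elasticity_anti hs hsz))
  linarith [h.g_anti s z hs hsz]

/-- To the left of `s`, the chord slopes of `v * (ρ - ρ s)` towards its zero `s` increase. -/
lemma chord_left (h : ElasticityProfile v ρ g) {x y s : ℝ} (hx : 0 < x)
    (hxy : x ≤ y) (hys : y ≤ s) :
    v y * (ρ y - ρ s) * (s - x) ≤ v x * (ρ x - ρ s) * (s - y) := by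
  have hy := hx.trans_le hxy
  obtain ⟨z, hxz, hzy, he⟩ := h.exists_mul_sub_slope (ρ s) hx hxy
  obtain ⟨w, hyw, hws, he'⟩ := h.exists_mul_sub_slope (ρ s) hy hys
  have hz := hx.trans_le hxz
  have hzw := hzy.trans hyw
  have hmono : v z * ρ z / z * (ρ z - ρ s) - g z ≤ v w * ρ w / w * (ρ w - ρ s) - g w := by
    have h1 := h.g_anti z w hz hzw
    have h2 := h.deriv_mono z w hz hzw
    have h3 := h.elasticity_anti hz hzw
    have h4 := h.elasticity_anti (hz.trans_le hzw) hws
    have h5 := h.deriv_nonpos hz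
    nlinarith [mul_nonneg (sub_nonneg.2 h2) (sub_nonneg.2 h4),
      mul_nonneg (neg_nonneg.2 h5) (sub_nonneg.2 h3)]
  have hprod := mul_le_mul_of_nonneg_right hmono
    (mul_nonneg (sub_nonneg.2 hxy) (sub_nonneg.2 hys))
  rw [sub_self, mul_zero, zero_sub] at he'
  linear_combination hprod + (s - y) * he - (y - x) * he'

/-- Composing with a homothety of ratio `κ ≥ 1` centred at `s > 0` makes `v` decay faster. -/
lemma homothety_quotient_le (h : ElasticityProfile v ρ g) {s κ x y : ℝ} (hs : 0 < s)
    (hκ : 1 ≤ κ) (hsx : s ≤ x) (hxy : x ≤ y) :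
    v (s + κ * (y - s)) / v y ≤ v (s + κ * (x - s)) / v x := by
  have hpos : ∀ z, s ≤ z → 0 < s + κ * (z - s) := fun z hz =>
    add_pos_of_pos_of_nonneg hs (mul_nonneg (by linarith) (by linarith))
  have hd : ∀ z, s ≤ z → HasDerivAt (fun z => v (s + κ * (z - s)) / v z)
      ((v (s + κ * (z - s)) * ρ (s + κ * (z - s)) / (s + κ * (z - s)) * κ * v z -
        v (s + κ * (z - s)) * (v z * ρ z / z)) / v z ^ 2) z := fun z hz => by
    have hz0 := hs.trans_le hz
    have haff : HasDerivAt (fun z => s + κ * (z - s)) κ z := by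
      simpa using (((hasDerivAt_id z).sub_const s).const_mul κ).const_add s
    exact ((h.hasDerivAt _ (hpos z hz)).comp z haff).div (h.hasDerivAt z hz0) (h.pos z hz0).ne'
  have hanti : AntitoneOn (fun z => v (s + κ * (z - s)) / v z) (Ici s) := by
    refine antitoneOn_of_deriv_nonpos (convex_Ici s)
      (fun z hz => (hd z hz).continuousAt.continuousWithinAt)
      (fun z hz => (hd z (interior_subset hz)).differentiableAt.differentiableWithinAt)
      fun z hz => ?_
    have hz : s ≤ z := interior_subset hz
    have hz0 := hs.trans_le hz
    rw [(hd z hz).deriv]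
    refine div_nonpos_of_nonpos_of_nonneg ?_ (sq_nonneg _)
    set Y := s + κ * (z - s) with hY
    have hzY : z ≤ Y := by nlinarith
    have hYκ : Y ≤ κ * z := by nlinarith
    have hY0 := hpos z hz
    have h1 := h.elasticity_anti hz0 hzY
    have h2 := h.nonpos z hz0
    have h3 : ρ Y * κ / Y ≤ ρ z / z := by
      rw [div_le_div_iff₀ hY0 hz0]
      nlinarith [mul_le_mul_of_nonneg_right h1 (mul_pos (by linarith : 0 < κ) hz0).le,
        mul_nonneg (neg_nonneg.2 h2) (sub_nonneg.2 hYκ)]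
    have h4 := mul_le_mul_of_nonneg_left h3 (mul_pos (h.pos Y hY0) (h.pos z hz0)).le
    calc _ = v Y * v z * (ρ Y * κ / Y) - v Y * v z * (ρ z / z) := by ring
      _ ≤ 0 := by linarith
  exact hanti hsx (hsx.trans hxy) hxy

/-- To the right of `s`, the chord slopes of `v * (ρ - ρ s)` from its zero `s` increase. -/
lemma chord_right (h : ElasticityProfile v ρ g) {x y s : ℝ} (hs : 0 < s)
    (hsx : s < x) (hxy : x ≤ y) :
    v x * (ρ x - ρ s) * (y - s) ≤ v y * (ρ y - ρ s) * (x - s) := by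
  have hxs : 0 < x - s := sub_pos.2 hsx
  obtain ⟨κ, hκdef⟩ : ∃ κ, κ = (y - s) / (x - s) := ⟨_, rfl⟩
  have hκ : 1 ≤ κ := by rw [hκdef, le_div_iff₀ hxs]; linarith
  have hκmul : κ * (x - s) = y - s := by rw [hκdef, div_mul_cancel₀ _ hxs.ne']
  have hpos : ∀ z, s ≤ z → 0 < s + κ * (z - s) := fun z hz =>
    add_pos_of_pos_of_nonneg hs (mul_nonneg (by linarith) (by linarith))
  have hd : ∀ z, s ≤ z → HasDerivAt (fun z => ρ (s + κ * (z - s)))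
      (-(g (s + κ * (z - s)) / v (s + κ * (z - s))) * κ) z := fun z hz => by
    have haff : HasDerivAt (fun z => s + κ * (z - s)) κ z := by
      simpa using (((hasDerivAt_id z).sub_const s).const_mul κ).const_add s
    exact (h.hasDerivAt_elasticity _ (hpos z hz)).comp z haff
  obtain ⟨z, ⟨hsz, hzx⟩, he⟩ := exists_ratio_hasDerivAt_eq_ratio_slope
    (fun z => ρ (s + κ * (z - s))) (fun z => -(g (s + κ * (z - s)) / v (s + κ * (z - s))) * κ) hsx
    (fun z hz => (hd z hz.1).continuousAt.continuousWithinAt) (fun z hz => hd z hz.1.le)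
    ρ (fun z => -(g z / v z))
    (fun z hz => (h.hasDerivAt_elasticity z (hs.trans_le hz.1)).continuousAt.continuousWithinAt)
    (fun z hz => h.hasDerivAt_elasticity z (hs.trans hz.1))
  have hquot := h.homothety_quotient_le hs hκ hsz.le hzx.le
  have hz0 := hs.trans hsz
  have hY0 := hpos z hsz.le
  simp only [hκmul, add_sub_cancel, sub_self, mul_zero, add_zero] at he hquot
  set Y := s + κ * (z - s) with hY
  have hzY : z ≤ Y := by nlinarith
  have hg := h.g_anti z Y hz0 hzY
  have hgz := h.g_pos z hz0
  have hvx := h.pos x (hs.trans hsx)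
  have hvy := h.pos y (by linarith)
  have hvz := h.pos z hz0
  have hvY := h.pos Y hY0
  have hρ := h.elasticity_lt hs hsx
  rw [div_le_div_iff₀ hvx hvz] at hquot
  have he2 : (ρ s - ρ y) * (g z * v Y) = (ρ s - ρ x) * κ * (g Y * v z) := by
    field_simp at he
    linear_combination -he
  have hρx : 0 ≤ (ρ s - ρ x) * κ := mul_nonneg (by linarith) (by linarith)
  have h1 : (ρ s - ρ y) * v Y ≤ (ρ s - ρ x) * κ * v z := by
    refine le_of_mul_le_mul_right ?_ hgz
    calc (ρ s - ρ y) * v Y * g z = (ρ s - ρ x) * κ * v z * g Y := by linear_combination he2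
      _ ≤ _ := mul_le_mul_of_nonneg_left hg (mul_nonneg hρx hvz.le)
  have h2 : (ρ s - ρ y) * v y ≤ (ρ s - ρ x) * κ * v x := by
    refine le_of_mul_le_mul_right ?_ hvY
    calc (ρ s - ρ y) * v y * v Y = (ρ s - ρ y) * v Y * v y := by ring
      _ ≤ (ρ s - ρ x) * κ * v z * v y := mul_le_mul_of_nonneg_right h1 hvy.le
      _ = (ρ s - ρ x) * κ * (v y * v z) := by ring
      _ ≤ (ρ s - ρ x) * κ * (v Y * v x) := mul_le_mul_of_nonneg_left hquot hρx
      _ = _ := by ring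
  have h3 := mul_le_mul_of_nonneg_right h2 hxs.le
  linear_combination h3 + (ρ s - ρ x) * v x * hκmul

/-- The `v`-weighted mean of the elasticities at `a` and `b` is attained in between. -/
lemma exists_mean (h : ElasticityProfile v ρ g) {P Q a b : ℝ} (hP : 0 < P) (hQ : 0 < Q)
    (ha : 0 < a) (hab : a ≤ b) :
    ∃ s ∈ Icc a b, P * (v a * (ρ a - ρ s)) + Q * (v b * (ρ b - ρ s)) = 0 := by
  have hPa := mul_pos hP (h.pos a ha)
  have hQb := mul_pos hQ (h.pos b (ha.trans_le hab))
  have hρ := h.elasticity_anti ha hab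
  have hc : (P * v a * ρ a + Q * v b * ρ b) / (P * v a + Q * v b) ∈ Icc (ρ b) (ρ a) := by
    constructor
    · rw [le_div_iff₀ (add_pos hPa hQb)]
      nlinarith
    · rw [div_le_iff₀ (add_pos hPa hQb)]
      nlinarith
  obtain ⟨s, hs, hse⟩ := intermediate_value_Icc' hab (fun z hz =>
    (h.hasDerivAt_elasticity z (ha.trans_le hz.1)).continuousAt.continuousWithinAt) hc
  refine ⟨s, hs, ?_⟩
  rw [eq_div_iff (add_pos hPa hQb).ne'] at hse
  linear_combination -hse

lemma weighted_elasticity_le_of_spread (h : ElasticityProfile v ρ g) {P Q a b A B : ℝ}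
    (hP : 0 < P) (hQ : 0 < Q) (hA : 0 < A) (hAa : A ≤ a) (hab : a ≤ b) (hbB : b ≤ B)
    (hsum : P * A + Q * B = P * a + Q * b) :
    (P * (v a * ρ a) + Q * (v b * ρ b)) * (P * v A + Q * v B) ≤
      (P * (v A * ρ A) + Q * (v B * ρ B)) * (P * v a + Q * v b) := by
  have ha := hA.trans_le hAa
  have hb := ha.trans_le hab
  obtain ⟨s, ⟨has, hsb⟩, hs⟩ := h.exists_mean hP hQ ha hab
  have h1 := mul_le_mul_of_nonneg_left (h.mul_sub_slope_le_left hA hAa has) hP.le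
  have h2 := mul_le_mul_of_nonneg_left
    (h.le_mul_sub_slope_right (ha.trans_le has) hsb hbB) hQ.le
  have h3 : 0 ≤ P * (v A * (ρ A - ρ s)) + Q * (v B * (ρ B - ρ s)) := by
    linear_combination h1 + h2 - hs + g s * hsum
  have h4 := mul_nonneg h3 (add_pos (mul_pos hP (h.pos a ha)) (mul_pos hQ (h.pos b hb))).le
  linear_combination h4 + (P * v A + Q * v B) * hs

lemma weighted_elasticity_le_of_swapped_spread (h : ElasticityProfile v ρ g) {P Q a b A B : ℝ}
    (hP : 0 < P) (hQ : 0 < Q) (hA : 0 < A) (hAa : A ≤ a) (hab : a < b) (hbB : b ≤ B)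
    (hsum : Q * A + P * B = P * a + Q * b) :
    (P * (v a * ρ a) + Q * (v b * ρ b)) * (Q * v A + P * v B) ≤
      (Q * (v A * ρ A) + P * (v B * ρ B)) * (P * v a + Q * v b) := by
  have ha := hA.trans_le hAa
  have hb := ha.trans hab
  obtain ⟨s, ⟨has, hsb⟩, hs⟩ := h.exists_mean hP hQ ha hab.le
  have hs0 := ha.trans_le has
  have hPa := mul_pos hP (h.pos a ha)
  have hQb := mul_pos hQ (h.pos b hb)
  have has' : a < s := by
    refine lt_of_le_of_ne has fun he => ?_
    subst he
    nlinarith [h.elasticity_lt ha hab]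
  have hsb' : s < b := by
    refine lt_of_le_of_ne hsb fun he => ?_
    subst he
    nlinarith [h.elasticity_lt ha hab]
  have hka : 0 < v a * (ρ a - ρ s) :=
    mul_pos (h.pos a ha) (sub_pos.2 (h.elasticity_lt ha has'))
  have hmean : (P + Q) * s ≤ P * a + Q * b := by
    have h1 := mul_le_mul_of_nonneg_left (h.mul_sub_slope_le_left ha has le_rfl) hP.le
    have h2 := mul_le_mul_of_nonneg_left (h.le_mul_sub_slope_right hs0 le_rfl hsb) hQ.le
    refine le_of_mul_le_mul_left ?_ (h.g_pos s hs0)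
    linear_combination h1 + h2 + hs
  have h3 : 0 ≤ Q * (v A * (ρ A - ρ s)) + P * (v B * (ρ B - ρ s)) := by
    rcases le_total P Q with hPQ | hQP
    · set B' := a + Q / P * (b - a) with hB'
      have hB'e : P * B' = P * a + Q * (b - a) := by rw [hB']; field_simp
      have hbB' : b ≤ B' := by
        refine le_of_mul_le_mul_left ?_ hP
        nlinarith
      have hB'B : B' ≤ B := by
        refine le_of_mul_le_mul_left ?_ hP
        nlinarith
      have h1 := mul_le_mul_of_nonneg_left (h.mul_sub_slope_le_left hA hAa has) hQ.le
      have h2 := mul_le_mul_of_nonneg_left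
        (h.le_mul_sub_slope_right hs0 (hsb.trans hbB') hB'B) hP.le
      have h4 := h.chord_right hs0 hsb' hbB'
      have h5 : P ^ 2 * (B' - s) ≤ Q ^ 2 * (b - s) := by
        linear_combination P * hB'e + mul_le_mul_of_nonneg_left hmean (sub_nonneg.2 hPQ)
      have h6 : 0 ≤ Q * (v a * (ρ a - ρ s)) + P * (v B' * (ρ B' - ρ s)) := by
        refine nonneg_of_mul_nonneg_left ?_ (mul_pos (mul_pos hP hQ) (sub_pos.2 hsb'))
        have h7 := mul_le_mul_of_nonneg_left h4 (mul_pos (mul_pos hP hP) hQ).le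
        have h8 := mul_le_mul_of_nonneg_left h5 (mul_pos hP hka).le
        linear_combination h7 + h8 + (-P ^ 2 * (B' - s)) * hs
      linear_combination h1 + h2 + h6 + g s * (hsum - hB'e)
    · set A' := b - P / Q * (b - a) with hA'
      have hA'e : Q * A' = Q * b - P * (b - a) := by rw [hA']; field_simp
      have hA'a : A' ≤ a := by
        refine le_of_mul_le_mul_left ?_ hQ
        nlinarith
      have hAA' : A ≤ A' := by
        refine le_of_mul_le_mul_left ?_ hQ
        nlinarith
      have h1 := mul_le_mul_of_nonneg_left
        (h.mul_sub_slope_le_left hA hAA' (hA'a.trans has)) hQ.le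
      have h2 := mul_le_mul_of_nonneg_left (h.le_mul_sub_slope_right hs0 hsb hbB) hP.le
      have h4 := h.chord_left (hA.trans_le hAA') hA'a has
      have h5 : P ^ 2 * (s - a) ≤ Q ^ 2 * (s - A') := by
        linear_combination Q * hA'e + mul_le_mul_of_nonneg_left hmean (sub_nonneg.2 hQP)
      have h6 : 0 ≤ Q * (v A' * (ρ A' - ρ s)) + P * (v b * (ρ b - ρ s)) := by
        refine nonneg_of_mul_nonneg_left ?_ (mul_pos hQ (sub_pos.2 has'))
        have h7 := mul_le_mul_of_nonneg_left h4 (mul_pos hQ hQ).le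
        have h8 := mul_le_mul_of_nonneg_left h5 hka.le
        linear_combination h7 + h8 - P * (s - a) * hs
      linear_combination h1 + h2 + h6 + g s * (hsum - hA'e)
  have h4 := mul_nonneg h3 (add_pos hPa hQb).le
  linear_combination h4 + (Q * v A + P * v B) * hs

/-- Schur convexity of the weighted mean elasticity along two-valued vectors. -/
lemma weighted_elasticity_le (h : ElasticityProfile v ρ g) {P Q a b A B : ℝ}
    (hP : 0 < P) (hQ : 0 < Q) (hA : 0 < A) (hB : 0 < B)
    (hmin : min A B ≤ min a b) (hmax : max a b ≤ max A B)
    (hsum : P * a + Q * b = P * A + Q * B) :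
    (P * (v a * ρ a) + Q * (v b * ρ b)) * (P * v A + Q * v B) ≤
      (P * (v A * ρ A) + Q * (v B * ρ B)) * (P * v a + Q * v b) := by
  rcases lt_trichotomy a b with hab | rfl | hba
  · rw [min_eq_left hab.le] at hmin
    rw [max_eq_right hab.le] at hmax
    rcases le_total A B with hAB | hBA
    · rw [min_eq_left hAB] at hmin
      rw [max_eq_right hAB] at hmax
      exact h.weighted_elasticity_le_of_spread hP hQ hA hmin hab.le hmax hsum.symm
    · rw [min_eq_right hBA] at hmin
      rw [max_eq_left hBA] at hmax
      linarith [h.weighted_elasticity_le_of_swapped_spread hP hQ hB hmin hab hmax (by linarith)]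
  · rw [min_self] at hmin
    rw [max_self] at hmax
    rcases le_total A B with hAB | hBA
    · rw [min_eq_left hAB] at hmin
      rw [max_eq_right hAB] at hmax
      exact h.weighted_elasticity_le_of_spread hP hQ hA hmin le_rfl hmax hsum.symm
    · rw [min_eq_right hBA] at hmin
      rw [max_eq_left hBA] at hmax
      linarith [h.weighted_elasticity_le_of_spread hQ hP hB hmin le_rfl hmax (by linarith)]
  · rw [min_eq_right hba.le] at hmin
    rw [max_eq_left hba.le] at hmax
    rcases le_total A B with hAB | hBA
    · rw [min_eq_left hAB] at hmin
      rw [max_eq_right hAB] at hmax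
      linarith [h.weighted_elasticity_le_of_swapped_spread hQ hP hA hmin hba hmax (by linarith)]
    · rw [min_eq_right hBA] at hmin
      rw [max_eq_left hBA] at hmax
      linarith [h.weighted_elasticity_le_of_spread hQ hP hB hmin hba.le hmax (by linarith)]

lemma monotoneOn_ratio (h : ElasticityProfile v ρ g) {P Q a b A B : ℝ}
    (hP : 0 < P) (hQ : 0 < Q) (ha : 0 < a) (hb : 0 < b) (hA : 0 < A) (hB : 0 < B)
    (hmin : min A B ≤ min a b) (hmax : max a b ≤ max A B)
    (hsum : P * a + Q * b = P * A + Q * B) :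
    MonotoneOn (fun t => (P * v (A * t) + Q * v (B * t)) / (P * v (a * t) + Q * v (b * t)))
      (Ioi 0) := by
  have hd : ∀ x y t : ℝ, 0 < x → 0 < y → 0 < t →
      HasDerivAt (fun t => P * v (x * t) + Q * v (y * t))
        ((P * (v (x * t) * ρ (x * t)) + Q * (v (y * t) * ρ (y * t))) / t) t := by
    intro x y t hx hy ht
    have hl : ∀ z : ℝ, 0 < z → HasDerivAt (fun t => v (z * t)) (v (z * t) * ρ (z * t) / t) t := by
      intro z hz
      have := (h.hasDerivAt (z * t) (mul_pos hz ht)).comp t ((hasDerivAt_id t).const_mul z)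
      refine this.congr_deriv ?_
      field_simp
    have hd := ((hl x hx).const_mul P).add ((hl y hy).const_mul Q)
    refine hd.congr_deriv ?_
    ring
  have hpos : ∀ t, 0 < t → 0 < P * v (a * t) + Q * v (b * t) := fun t ht =>
    add_pos (mul_pos hP (h.pos _ (mul_pos ha ht))) (mul_pos hQ (h.pos _ (mul_pos hb ht)))
  have hd' := fun t (ht : 0 < t) => (hd A B t hA hB ht).div (hd a b t ha hb ht) (hpos t ht).ne'
  refine monotoneOn_of_deriv_nonneg (convex_Ioi 0)
    (fun t ht => (hd' t ht).continuousAt.continuousWithinAt)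
    (fun t ht => (hd' t (interior_subset ht)).differentiableAt.differentiableWithinAt)
    fun t ht => ?_
  have ht : 0 < t := interior_subset ht
  refine (hd' t ht).deriv.symm ▸ div_nonneg ?_ (sq_nonneg _)
  have key := h.weighted_elasticity_le hP hQ (mul_pos hA ht) (mul_pos hB ht)
    (a := a * t) (b := b * t)
    (by rw [← min_mul_of_nonneg _ _ ht.le, ← min_mul_of_nonneg _ _ ht.le]; gcongr)
    (by rw [← max_mul_of_nonneg _ _ ht.le, ← max_mul_of_nonneg _ _ ht.le]; gcongr)
    (by linear_combination t * hsum)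
  rw [div_mul_eq_mul_div, mul_div_assoc', ← sub_div]
  exact div_nonneg (by linarith) ht.le

end ElasticityProfile

lemma monotoneOn_Ici_of_hasDerivAt {f f' : ℝ → ℝ} (hf : ∀ x, HasDerivAt f (f' x) x)
    (hf' : ∀ x, 0 ≤ x → 0 ≤ f' x) : MonotoneOn f (Ici 0) :=
  monotoneOn_of_deriv_nonneg (convex_Ici 0)
    (fun x _ => (hf x).continuousAt.continuousWithinAt)
    (fun x _ => (hf x).differentiableAt.differentiableWithinAt)
    fun x hx => (hf x).deriv ▸ hf' x (interior_subset hx)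

lemma nonneg_of_hasDerivAt {f f' : ℝ → ℝ} (hf : ∀ x, HasDerivAt f (f' x) x) (h0 : f 0 = 0)
    (hf' : ∀ x, 0 ≤ x → 0 ≤ f' x) (x : ℝ) (hx : 0 ≤ x) : 0 ≤ f x :=
  h0 ▸ monotoneOn_Ici_of_hasDerivAt hf hf' (mem_Ici.2 le_rfl) hx hx

lemma linear_mul_exp_nonneg {x : ℝ} (hx : 0 ≤ x) : 0 ≤ x * exp x - exp x + 1 := by
  refine nonneg_of_hasDerivAt (f := fun x => x * exp x - exp x + 1) (f' := fun x => x * exp x)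
    (fun x => ?_) (by simp) (fun x hx => mul_nonneg hx (exp_pos x).le) x hx
  have hd := (((hasDerivAt_id x).mul (hasDerivAt_exp x)).sub (hasDerivAt_exp x)).add_const 1
  refine hd.congr_deriv ?_
  simp

lemma exp_convexity_bound {x : ℝ} (hx : 0 ≤ x) : 0 ≤ (x - 2) * exp x + x + 2 := by
  refine nonneg_of_hasDerivAt (f := fun x => (x - 2) * exp x + x + 2)
    (f' := fun x => x * exp x - exp x + 1)
    (fun x => ?_) (by simp) (fun x hx => linear_mul_exp_nonneg hx) x hx
  have hd := (((((hasDerivAt_id x).sub_const 2).mul (hasDerivAt_exp x)).add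
    (hasDerivAt_id x)).add_const 2)
  refine hd.congr_deriv ?_
  simp
  ring

lemma exp_quadratic_bound {x : ℝ} (hx : 0 ≤ x) :
    0 ≤ (x - 1) * exp x ^ 2 - (2 * x ^ 2 - 2 * x - 2) * exp x - (1 + 3 * x + x ^ 2) := by
  have hE : ∀ x, HasDerivAt (fun x => exp x ^ 2) (2 * exp x ^ 2) x := fun x => by
    have hd := (hasDerivAt_exp x).pow 2
    refine hd.congr_deriv ?_
    simp
    ring
  have hsq : ∀ x : ℝ, HasDerivAt (fun x => x ^ 2) (2 * x) x := fun x => by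
    simpa using hasDerivAt_pow 2 x
  have h2 : ∀ x, 0 ≤ x →
      0 ≤ 4 * x * exp x ^ 2 - (2 * x ^ 2 + 6 * x - 2) * exp x - 2 := by
    refine nonneg_of_hasDerivAt
      (f' := fun x => exp x * ((4 + 8 * x) * exp x - (2 * x ^ 2 + 10 * x + 4))) (fun x => ?_)
      (by simp) fun x hx => mul_nonneg (exp_pos x).le ?_
    · have hd := ((((hasDerivAt_id x).const_mul 4).mul (hE x)).sub
        (((((hsq x).const_mul 2).add ((hasDerivAt_id x).const_mul 6)).sub_const 2).mul
          (hasDerivAt_exp x))).sub_const 2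
      refine hd.congr_deriv ?_
      simp
      ring
    · nlinarith [add_one_le_exp x]
  have h1 : ∀ x, 0 ≤ x →
      0 ≤ (2 * x - 1) * exp x ^ 2 - (2 * x ^ 2 + 2 * x - 4) * exp x - 2 * x - 3 := by
    refine nonneg_of_hasDerivAt (fun x => ?_) (by norm_num) h2
    have hd := (((((((hasDerivAt_id x).const_mul 2).sub_const 1).mul (hE x)).sub
      (((((hsq x).const_mul 2).add ((hasDerivAt_id x).const_mul 2)).sub_const 4).mul
        (hasDerivAt_exp x))).sub ((hasDerivAt_id x).const_mul 2)).sub_const 3)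
    refine hd.congr_deriv ?_
    simp
    ring
  refine nonneg_of_hasDerivAt
    (f := fun x => (x - 1) * exp x ^ 2 - (2 * x ^ 2 - 2 * x - 2) * exp x - (1 + 3 * x + x ^ 2))
    (fun x => ?_) (by norm_num) h1 x hx
  have hd := ((((hasDerivAt_id x).sub_const 1).mul (hE x)).sub
    (((((hsq x).const_mul 2).sub ((hasDerivAt_id x).const_mul 2)).sub_const 2).mul
      (hasDerivAt_exp x))).sub ((((hasDerivAt_id x).const_mul 3).const_add 1).add (hsq x))
  refine hd.congr_deriv ?_
  simp
  ring

lemma exp_sub_one_pos {x : ℝ} (hx : 0 < x) : 0 < exp x - 1 := by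
  linarith [add_one_lt_exp hx.ne']

lemma antitoneOn_Ioi_of_hasDerivAt {f f' : ℝ → ℝ} (hf : ∀ x, 0 < x → HasDerivAt f (f' x) x)
    (hf' : ∀ x, 0 < x → f' x ≤ 0) : AntitoneOn f (Ioi 0) :=
  antitoneOn_of_deriv_nonpos (convex_Ioi 0)
    (fun x hx => (hf x hx).continuousAt.continuousWithinAt)
    (fun x hx => (hf x (interior_subset hx)).differentiableAt.differentiableWithinAt)
    fun x hx => (hf x (interior_subset hx)).deriv ▸ hf' x (interior_subset hx)

lemma hasDerivAt_div_exp_sub_one {x : ℝ} (hx : 0 < x) :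
    HasDerivAt (fun x => x / (exp x - 1)) (-((x * exp x - exp x + 1) / (exp x - 1) ^ 2)) x := by
  have hd := (hasDerivAt_id x).div ((hasDerivAt_exp x).sub_const 1) (exp_sub_one_pos hx).ne'
  refine hd.congr_deriv ?_
  simp
  ring

/-- The negative derivative of `x / (exp x - 1)` decreases. -/
lemma antitoneOn_neg_deriv_div_exp_sub_one :
    AntitoneOn (fun x => (x * exp x - exp x + 1) / (exp x - 1) ^ 2) (Ioi 0) := by
  refine antitoneOn_Ioi_of_hasDerivAt
    (f' := fun x => -(exp x * ((x - 2) * exp x + x + 2) / (exp x - 1) ^ 3)) (fun x hx => ?_)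
    fun x hx => neg_nonpos.2 (div_nonneg
      (mul_nonneg (exp_pos x).le (exp_convexity_bound hx.le)) (pow_pos (exp_sub_one_pos hx) 3).le)
  have hne := (exp_sub_one_pos hx).ne'
  have hd := ((((hasDerivAt_id x).mul (hasDerivAt_exp x)).sub (hasDerivAt_exp x)).add_const 1).div
    (((hasDerivAt_exp x).sub_const 1).pow 2) (pow_ne_zero 2 hne)
  refine hd.congr_deriv ?_
  simp
  field_simp
  ring

/-- With `u x = x / (exp x - 1)`, the function `u * (1 + u')` decreases. -/
lemma antitoneOn_elasticity_factor :
    AntitoneOn (fun x => x * exp x * (exp x - 1 - x) / (exp x - 1) ^ 3) (Ioi 0) := by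
  refine antitoneOn_Ioi_of_hasDerivAt
    (f' := fun x => -(exp x * ((x - 1) * exp x ^ 2 - (2 * x ^ 2 - 2 * x - 2) * exp x -
      (1 + 3 * x + x ^ 2)) / (exp x - 1) ^ 4)) (fun x hx => ?_)
    fun x hx => neg_nonpos.2 (div_nonneg
      (mul_nonneg (exp_pos x).le (exp_quadratic_bound hx.le)) (pow_pos (exp_sub_one_pos hx) 4).le)
  have hne := (exp_sub_one_pos hx).ne'
  have hd := (((hasDerivAt_id x).mul (hasDerivAt_exp x)).mul
    (((hasDerivAt_exp x).sub_const 1).sub (hasDerivAt_id x))).div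
    (((hasDerivAt_exp x).sub_const 1).pow 3) (pow_ne_zero 3 hne)
  refine hd.congr_deriv ?_
  simp
  field_simp
  ring

lemma elasticityProfile_weibull {α : ℝ} (hα : 0 < α) (hα1 : α ≤ 1) :
    ElasticityProfile (fun s => s ^ α / (exp (s ^ α) - 1))
      (fun s => α * (1 - s ^ α - s ^ α / (exp (s ^ α) - 1)))
      (fun s => α ^ 2 * s ^ (α - 1) *
        (s ^ α * exp (s ^ α) * (exp (s ^ α) - 1 - s ^ α) / (exp (s ^ α) - 1) ^ 3)) := by
  have hx : ∀ s : ℝ, 0 < s → 0 < s ^ α := fun s hs => rpow_pos_of_pos hs α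
  have hpow : ∀ s : ℝ, 0 < s → HasDerivAt (fun s => s ^ α) (α * s ^ (α - 1)) s := fun s hs =>
    hasDerivAt_rpow_const (Or.inl hs.ne')
  have hmono : ∀ s t : ℝ, 0 < s → s ≤ t → s ^ α ≤ t ^ α := fun s t hs hst =>
    rpow_le_rpow hs.le hst hα.le
  have hanti : ∀ s t : ℝ, 0 < s → s ≤ t → t ^ (α - 1) ≤ s ^ (α - 1) := fun s t hs hst =>
    rpow_le_rpow_of_nonpos hs hst (by linarith)
  have hu : ∀ s : ℝ, 0 < s → HasDerivAt (fun s => s ^ α / (exp (s ^ α) - 1))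
      (-((s ^ α * exp (s ^ α) - exp (s ^ α) + 1) / (exp (s ^ α) - 1) ^ 2) * (α * s ^ (α - 1))) s :=
    fun s hs => HasDerivAt.comp (h₂ := fun x => x / (exp x - 1)) s
      (hasDerivAt_div_exp_sub_one (hx s hs)) (hpow s hs)
  have hderiv : ∀ s : ℝ, 0 < s →
      s ^ α / (exp (s ^ α) - 1) * (α * (1 - s ^ α - s ^ α / (exp (s ^ α) - 1))) / s =
      -((s ^ α * exp (s ^ α) - exp (s ^ α) + 1) / (exp (s ^ α) - 1) ^ 2) *
        (α * s ^ (α - 1)) := fun s hs => by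
    have hne := (exp_sub_one_pos (hx s hs)).ne'
    rw [rpow_sub_one hs.ne']
    field_simp
    ring
  have hnum : ∀ s : ℝ, 0 < s →
      0 ≤ (s ^ α * exp (s ^ α) - exp (s ^ α) + 1) / (exp (s ^ α) - 1) ^ 2 := fun s hs =>
    div_nonneg (linear_mul_exp_nonneg (hx s hs).le) (sq_nonneg _)
  have hfac : ∀ s : ℝ, 0 < s →
      0 < s ^ α * exp (s ^ α) * (exp (s ^ α) - 1 - s ^ α) / (exp (s ^ α) - 1) ^ 3 := fun s hs =>
    div_pos (mul_pos (mul_pos (hx s hs) (exp_pos _))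
      (by linarith [add_one_lt_exp (hx s hs).ne'])) (pow_pos (exp_sub_one_pos (hx s hs)) 3)
  refine ⟨fun s hs => div_pos (hx s hs) (exp_sub_one_pos (hx s hs)), fun s hs => ?_,
    fun s hs => ?_, fun s hs => ?_, fun s hs => ?_, fun s t hs hst => ?_, fun s t hs hst => ?_⟩
  · rw [hderiv s hs]
    exact hu s hs
  · refine mul_nonpos_of_nonneg_of_nonpos hα.le ?_
    have hpos := exp_sub_one_pos (hx s hs)
    have : 1 - s ^ α ≤ s ^ α / (exp (s ^ α) - 1) := by
      rw [le_div_iff₀ hpos]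
      linarith [linear_mul_exp_nonneg (hx s hs).le]
    linarith
  · have hne := (exp_sub_one_pos (hx s hs)).ne'
    have hxne := (hx s hs).ne'
    have hd := ((((hpow s hs).const_sub 1).sub (hu s hs)).const_mul α)
    refine hd.congr_deriv ?_
    field_simp
    ring
  · exact mul_pos (mul_pos (pow_pos hα 2) (rpow_pos_of_pos hs _)) (hfac s hs)
  · have ht := hs.trans_le hst
    exact mul_le_mul (mul_le_mul_of_nonneg_left (hanti s t hs hst) (sq_nonneg α))
      (antitoneOn_elasticity_factor (hx s hs) (hx t ht) (hmono s t hs hst)) (hfac t ht).le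
      (mul_nonneg (sq_nonneg α) (rpow_pos_of_pos hs _).le)
  · have ht := hs.trans_le hst
    simp only [hderiv s hs, hderiv t ht, neg_mul, neg_le_neg_iff]
    exact mul_le_mul (antitoneOn_neg_deriv_div_exp_sub_one (hx s hs) (hx t ht) (hmono s t hs hst))
      (mul_le_mul_of_nonneg_left (hanti s t hs hst) hα.le)
      (mul_nonneg hα.le (rpow_pos_of_pos ht _).le) (hnum s hs)

lemma MajorizedBy.exists_le {n : ℕ} {x y : Fin n → ℝ} (h : MajorizedBy x y) (i : Fin n) :
    ∃ j, y j ≤ x i := by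
  obtain ⟨u, hu, hle⟩ := h.1 {i}
  rw [Finset.card_singleton, Finset.card_eq_one] at hu
  obtain ⟨j, rfl⟩ := hu
  exact ⟨j, by simpa using hle⟩

lemma MajorizedBy.exists_ge {n : ℕ} {x y : Fin n → ℝ} (h : MajorizedBy x y) (i : Fin n) :
    ∃ j, x i ≤ y j := by
  obtain ⟨u, hu, hle⟩ := h.1 {i}ᶜ
  have hcard : uᶜ.card = 1 := by
    have h1 := Finset.card_add_card_compl u
    have h2 := Finset.card_add_card_compl ({i} : Finset (Fin n))
    rw [Finset.card_singleton] at h2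
    omega
  obtain ⟨j, hj⟩ := Finset.card_eq_one.1 hcard
  refine ⟨j, ?_⟩
  have h1 := Finset.sum_add_sum_compl u y
  have h2 := Finset.sum_add_sum_compl {i} x
  rw [hj, Finset.sum_singleton] at h1
  rw [Finset.sum_singleton] at h2
  linarith [h.2]

lemma sum_two_valued (p q : ℕ) (a b : ℝ) :
    ∑ i : Fin (p + q), (if (i : ℕ) < p then a else b) = p * a + q * b := by
  simp [Fin.sum_univ_add]

/-- For `0 < α ≤ 1`, if the vector of `p` copies of `λ₁` followed by `q` copies of `λ₂`
is majorized by the vector of `p` copies of `θ₁` followed by `q` copies of `θ₂`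
(`p + q = n`), then the ratio of reverse hazard rates of the multiple-outlier parallel
Weibull systems, `[p·u(θ₁ t) + q·u(θ₂ t)] / [p·u(λ₁ t) + q·u(λ₂ t)]` with
`u(s) = s^α / (e^{s^α} − 1)`, is increasing in `t` on `(0, ∞)`. -/
theorem multiple_outlier_weibull_rhr_ratio_monotone
    (α lam₁ lam₂ θ₁ θ₂ : ℝ) (hα : 0 < α) (hα1 : α ≤ 1)
    (hlam₁ : 0 < lam₁) (hlam₂ : 0 < lam₂) (hθ₁ : 0 < θ₁) (hθ₂ : 0 < θ₂)
    (p q n : ℕ) (hp : 0 < p) (hq : 0 < q) (hn : p + q = n)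
    (hmaj : MajorizedBy (fun i : Fin n => if (i : ℕ) < p then lam₁ else lam₂)
      (fun i : Fin n => if (i : ℕ) < p then θ₁ else θ₂)) :
    MonotoneOn
      (fun t : ℝ =>
        ((p : ℝ) * ((θ₁ * t) ^ α / (exp ((θ₁ * t) ^ α) - 1)) +
            (q : ℝ) * ((θ₂ * t) ^ α / (exp ((θ₂ * t) ^ α) - 1))) /
          ((p : ℝ) * ((lam₁ * t) ^ α / (exp ((lam₁ * t) ^ α) - 1)) +
            (q : ℝ) * ((lam₂ * t) ^ α / (exp ((lam₂ * t) ^ α) - 1))))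
      (Ioi (0 : ℝ)) := by
  subst hn
  have hle := hmaj.exists_le
  have hge := hmaj.exists_ge
  have hsum := hmaj.2
  rw [sum_two_valued, sum_two_valued] at hsum
  have hmin : ∀ j : Fin (p + q), min θ₁ θ₂ ≤ if (j : ℕ) < p then θ₁ else θ₂ := fun j => by
    split_ifs <;> simp
  have hmax : ∀ j : Fin (p + q), (if (j : ℕ) < p then θ₁ else θ₂) ≤ max θ₁ θ₂ := fun j => by
    split_ifs <;> simp
  obtain ⟨j₁, h₁⟩ := hle ⟨0, by omega⟩
  obtain ⟨j₂, h₂⟩ := hle ⟨p, by omega⟩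
  obtain ⟨j₃, h₃⟩ := hge ⟨0, by omega⟩
  obtain ⟨j₄, h₄⟩ := hge ⟨p, by omega⟩
  simp only [hp, if_true, lt_irrefl, if_false] at h₁ h₂ h₃ h₄
  exact (elasticityProfile_weibull hα hα1).monotoneOn_ratio (Nat.cast_pos.2 hp)
    (Nat.cast_pos.2 hq) hlam₁ hlam₂ hθ₁ hθ₂
    (le_min ((hmin j₁).trans h₁) ((hmin j₂).trans h₂))
    (max_le (h₃.trans (hmax j₃)) (h₄.trans (hmax j₄))) hsum
end
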